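/- arXiv:0707.4101 — 3 statements merged into one kernel-verified Lean document; each statement's English description precedes it below -/
import Mathlib

section
/- Let n be odd and k ≥ 1, and fix a reduced residue b₁ mod k. Then the number of residues b₂ mod k with (b₂,k) = 1 and (n − b₁ − b₂, k) = 1 is at least 2^{max{0, ν₂(k)−1}} · ∏_{p^l ∥ k, p ≠ 2} p^{l−1}(p−2) = φ(k) · ∏_{p | k, p ≠ 2} (p−2)/(p−1), where ν₂(k) is the 2-adic valuation of k and p^l ∥ k means p^l | k but p^{l+1} ∤ k. -/
open Finset MeasureTheory

noncomputable section

/-- `e x = e^{2πix}`. -/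
def e (x : ℝ) : ℂ := Complex.exp (2 * Real.pi * Complex.I * x)

/-- The exponential sum `S_{b,k}(α) = ∑_{m ≤ n, m ≡ b (k)} Λ(m) e(αm)`. -/
def S (n k b : ℕ) (α : ℝ) : ℂ :=
  ∑ m ∈ Finset.Icc 1 n,
    if m % k = b % k then (ArithmeticFunction.vonMangoldt m : ℂ) * e (α * m) else 0

/-- `J₃(n) = ∑_{m₁+m₂+m₃=n, mᵢ ≡ bᵢ (k)} Λ(m₁)Λ(m₂)Λ(m₃)`. -/
def J3 (n k b1 b2 b3 : ℕ) : ℝ :=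
  ∑ m1 ∈ Finset.Icc 1 n, ∑ m2 ∈ Finset.Icc 1 n, ∑ m3 ∈ Finset.Icc 1 n,
    if m1 + m2 + m3 = n ∧ m1 % k = b1 % k ∧ m2 % k = b2 % k ∧ m3 % k = b3 % k then
      ArithmeticFunction.vonMangoldt m1 * ArithmeticFunction.vonMangoldt m2 *
        ArithmeticFunction.vonMangoldt m3
    else 0

/-- `R₃(n) = ∑_{p₁+p₂+p₃=n, pᵢ ≡ bᵢ (k), pᵢ prime} log p₁ log p₂ log p₃`. -/
def R3 (n k b1 b2 b3 : ℕ) : ℝ :=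
  ∑ p1 ∈ Finset.Icc 1 n, ∑ p2 ∈ Finset.Icc 1 n, ∑ p3 ∈ Finset.Icc 1 n,
    if p1.Prime ∧ p2.Prime ∧ p3.Prime ∧ p1 + p2 + p3 = n ∧
        p1 % k = b1 % k ∧ p2 % k = b2 % k ∧ p3 % k = b3 % k then
      Real.log p1 * Real.log p2 * Real.log p3
    else 0

/-- The singular series `𝔖(n,k)`. -/
def SingularSeries (n k : ℕ) : ℝ :=
  (if Odd k then 2 else 8)
    * ∏ p ∈ k.primeFactors.filter (fun p => p ≠ 2), (p : ℝ) ^ 3 / (((p : ℝ) - 1) ^ 3 + 1)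
    * ∏ p ∈ n.primeFactors.filter (fun p => p ≠ 2 ∧ ¬ p ∣ k),
        (((p : ℝ) - 1) * (((p : ℝ) - 1) ^ 2 - 1)) / (((p : ℝ) - 1) ^ 3 + 1)
    * ∏' p : Nat.Primes, if 2 < (p : ℕ) then 1 + 1 / (((p : ℕ) : ℝ) - 1) ^ 3 else 1

/-- The residue `b₃` with `b₃ ≡ n - b₁ - b₂ (mod k)`, `0 ≤ b₃ < k`. -/
def bthree (n k b1 b2 : ℕ) : ℕ := (((n : ℤ) - b1 - b2) % (k : ℤ)).toNat

/-- The reduced residues `0 ≤ b < k`, `(b,k) = 1`. -/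
def redRes (k : ℕ) : Finset ℕ := (Finset.range k).filter (fun b => Nat.Coprime b k)

/-- For fixed `b₁`, the admissible `b₂` mod `k`:
reduced residues with `(n - b₁ - b₂, k) = 1`. -/
def admFor (n k b1 : ℕ) : Finset ℕ :=
  (redRes k).filter (fun b2 => Int.gcd ((n : ℤ) - b1 - b2) k = 1)

/-- The admissible pairs `b₁, b₂` of reduced residues mod `k`. -/
def admPairs (n k : ℕ) : Finset (ℕ × ℕ) :=
  (redRes k ×ˢ redRes k).filter (fun b => Int.gcd ((n : ℤ) - b.1 - b.2) k = 1)

/-- The admissible triplets `b₁, b₂, b₃` of reduced residues mod `k`: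
`n ≡ b₁ + b₂ + b₃ (mod k)`. -/
def admTriplets (n k : ℕ) : Finset (ℕ × ℕ × ℕ) :=
  (Finset.range k ×ˢ Finset.range k ×ˢ Finset.range k).filter
    (fun b => Nat.Coprime b.1 k ∧ Nat.Coprime b.2.1 k ∧ Nat.Coprime b.2.2 k ∧
      n % k = (b.1 + b.2.1 + b.2.2) % k)

/-- The range `D < k ≤ 2D` of moduli. -/
def kRange (D : ℝ) : Finset ℕ :=
  (Finset.range (⌊2 * D⌋₊ + 1)).filter (fun k => D < (k : ℝ) ∧ (k : ℝ) ≤ 2 * D)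

/-- The major arcs `𝔐`. -/
def majorArcs (n : ℕ) (D B : ℝ) : Set ℝ :=
  ⋃ (q : ℕ) (_ : 1 ≤ q ∧ (q : ℝ) ≤ D * Real.log n ^ B) (a : ℕ)
      (_ : 0 < a ∧ a < q ∧ Nat.Coprime a q),
    Set.Ioo ((a : ℝ) / q - D * Real.log n ^ B / (q * n))
      ((a : ℝ) / q + D * Real.log n ^ B / (q * n))

/-- The minor arcs `𝔪`. -/
def minorArcs (n : ℕ) (D B : ℝ) : Set ℝ :=
  Set.Ioo (-(D * Real.log n ^ B / n)) (1 - D * Real.log n ^ B / n) \ majorArcs n D B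

/-- `J₃^𝔐(n)`, the major-arc part of the integral. -/
def J3M (n k b1 b2 b3 : ℕ) (D B : ℝ) : ℂ :=
  ∫ α in majorArcs n D B, S n k b1 α * S n k b2 α * S n k b3 α * e (-(n * α))

/-- `J₃^𝔪(n)`, the minor-arc part of the integral. -/
def J3m (n k b1 b2 b3 : ℕ) (D B : ℝ) : ℂ :=
  ∫ α in minorArcs n D B, S n k b1 α * S n k b2 α * S n k b3 α * e (-(n * α))

/-- `W₃`: the number of solutions of `p^l + q^j + r^m = n` in primes `p,q,r` and
positive exponents `l,j,m`, at least one exponent being `≥ 2`, with the prime powers in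
the residue classes `b₁,b₂,b₃` mod `k`. -/
def W3 (n k b1 b2 b3 : ℕ) : ℕ :=
  Set.ncard {x : (ℕ × ℕ) × (ℕ × ℕ) × (ℕ × ℕ) |
    x.1.1.Prime ∧ x.2.1.1.Prime ∧ x.2.2.1.Prime ∧
    1 ≤ x.1.2 ∧ 1 ≤ x.2.1.2 ∧ 1 ≤ x.2.2.2 ∧
    (2 ≤ x.1.2 ∨ 2 ≤ x.2.1.2 ∨ 2 ≤ x.2.2.2) ∧
    x.1.1 ^ x.1.2 + x.2.1.1 ^ x.2.1.2 + x.2.2.1 ^ x.2.2.2 = n ∧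
    x.1.1 ^ x.1.2 % k = b1 % k ∧ x.2.1.1 ^ x.2.1.2 % k = b2 % k ∧
    x.2.2.1 ^ x.2.2.2 % k = b3 % k}

/-- `n` has a representation `n = p₁ + p₂ + p₃` in primes with `pᵢ ≡ bᵢ (mod k)`. -/
def HasRep (n k b1 b2 b3 : ℕ) : Prop :=
  ∃ p1 p2 p3 : ℕ, p1.Prime ∧ p2.Prime ∧ p3.Prime ∧ p1 + p2 + p3 = n ∧
    p1 % k = b1 % k ∧ p2 % k = b2 % k ∧ p3 % k = b3 % k

open scoped Classical in
/-- The admissible triplets mod `k` without a representation of `n`. -/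
def badTriplets (n k : ℕ) : Finset (ℕ × ℕ × ℕ) :=
  (admTriplets n k).filter (fun b => ¬ HasRep n k b.1 b.2.1 b.2.2)

open scoped Classical in
/-- `T(k)`: the number of admissible pairs mod `k` with `R₃(n) = 0`. -/
def Tcount (n k : ℕ) : ℕ :=
  ((admPairs n k).filter (fun b => R3 n k b.1 b.2 (bthree n k b.1 b.2) = 0)).card

/-- `‖x‖`, the distance from `x` to the nearest integer. -/
def distNearestInt (x : ℝ) : ℝ := |x - round x|

/-- The elements `x` of a ring for which both `x` and `c - x` are units. -/
def unitComplements {R : Type*} [Ring R] (c : R) : Set R := {x | IsUnit x ∧ IsUnit (c - x)}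

lemma ncard_unitComplements_map {R R' : Type*} [Ring R] [Ring R'] (f : R ≃+* R') (c : R) :
    (unitComplements (f c)).ncard = (unitComplements c).ncard := by
  rw [← Set.ncard_image_of_injective (unitComplements c) f.injective]
  congr 1
  ext y
  obtain ⟨x, rfl⟩ := f.surjective y
  simp only [unitComplements, Set.mem_ofPred_eq, f.injective.mem_set_image, ← map_sub,
    MulEquiv.isUnit_map]

lemma unitComplements_prod {R R' : Type*} [Ring R] [Ring R'] (c : R × R') :
    unitComplements c = unitComplements c.1 ×ˢ unitComplements c.2 := by
  ext x
  simp only [unitComplements, Set.mem_ofPred_eq, Set.mem_prod, Prod.isUnit_iff, Prod.fst_sub,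
    Prod.snd_sub]
  tauto

lemma ncard_unitComplements_mul {a b : ℕ} (h : a.Coprime b) (c : ℤ) :
    (unitComplements (c : ZMod (a * b))).ncard =
      (unitComplements (c : ZMod a)).ncard * (unitComplements (c : ZMod b)).ncard := by
  rw [← ncard_unitComplements_map (ZMod.chineseRemainder h), unitComplements_prod, Set.ncard_prod]
  simp

lemma ncard_setOf_isUnit_zmod (k : ℕ) [NeZero k] :
    {x : ZMod k | IsUnit x}.ncard = k.totient := by
  have : {x : ZMod k | IsUnit x} = (fun u : (ZMod k)ˣ => (u : ZMod k)) '' Set.univ := by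
    ext x
    simp [IsUnit]
  rw [this, Set.ncard_image_of_injective _ Units.val_injective, Set.ncard_univ,
    Nat.card_eq_fintype_card, ZMod.card_units_eq_totient]

lemma two_mul_totient_le_ncard_unitComplements (k : ℕ) [NeZero k] (c : ZMod k) :
    2 * k.totient ≤ (unitComplements c).ncard + k := by
  have hV : {x : ZMod k | IsUnit (c - x)}.ncard = k.totient := by
    rw [← ncard_setOf_isUnit_zmod,
      ← Set.ncard_image_of_injective {x : ZMod k | IsUnit x} (sub_right_injective (b := c))]
    congr 1
    ext x
    simp only [Set.mem_ofPred_eq, Set.mem_image]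
    exact ⟨fun hx => ⟨c - x, hx, sub_sub_cancel c x⟩,
      by rintro ⟨y, hy, rfl⟩; rwa [sub_sub_cancel]⟩
  have h1 := Set.ncard_union_add_ncard_inter {x : ZMod k | IsUnit x} {x : ZMod k | IsUnit (c - x)}
  have h2 := Set.ncard_le_card ({x : ZMod k | IsUnit x} ∪ {x : ZMod k | IsUnit (c - x)})
  rw [ncard_setOf_isUnit_zmod, hV, ← Set.ofPred_and] at h1
  rw [Nat.card_zmod] at h2
  change _ + (unitComplements c).ncard = _ at h1
  omega

lemma isUnit_intCast_zmod_two_pow {l : ℕ} (hl : 0 < l) (m : ℤ) :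
    IsUnit (m : ZMod (2 ^ l)) ↔ Odd m := by
  rw [ZMod.coe_int_isUnit_iff_isCoprime]
  push_cast
  rw [IsCoprime.pow_left_iff hl, Int.isCoprime_two_left]

lemma ncard_unitComplements_two_pow {l : ℕ} (hl : 0 < l) {c : ℤ} (hc : Even c) :
    (unitComplements (c : ZMod (2 ^ l))).ncard = 2 ^ (l - 1) := by
  have : unitComplements (c : ZMod (2 ^ l)) = {x | IsUnit x} := by
    ext x
    obtain ⟨m, rfl⟩ := ZMod.intCast_surjective x
    rw [unitComplements, Set.mem_ofPred_eq, Set.mem_ofPred_eq, ← Int.cast_sub,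
      isUnit_intCast_zmod_two_pow hl, isUnit_intCast_zmod_two_pow hl, Int.odd_sub]
    simp [Int.not_odd_iff_even.mpr hc]
  rw [this, ncard_setOf_isUnit_zmod, Nat.totient_prime_pow Nat.prime_two hl,
    Nat.add_one_sub_one, mul_one]

lemma prime_pow_le_ncard_unitComplements {p l : ℕ} (hp : p.Prime) (hl : 0 < l) (c : ZMod (p ^ l)) :
    p ^ (l - 1) * (p - 2) ≤ (unitComplements c).ncard := by
  have : NeZero (p ^ l) := ⟨pow_ne_zero _ hp.ne_zero⟩
  have h := two_mul_totient_le_ncard_unitComplements (p ^ l) c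
  rw [Nat.totient_prime_pow hp hl] at h
  obtain ⟨q, rfl⟩ := Nat.exists_eq_add_of_le hp.two_le
  obtain ⟨l, rfl⟩ := Nat.exists_eq_add_of_lt hl
  simp only [zero_add, Nat.add_sub_cancel, Nat.add_sub_cancel_left, pow_succ,
    show 2 + q - 1 = 1 + q by omega] at h ⊢
  nlinarith

lemma factorization_prod_le_ncard_unitComplements (k : ℕ) (c : ℤ) (hk : k ≠ 0)
    (hc : 2 ∣ k → Even c) :
    (k.factorization.prod fun p l => if p = 2 then 2 ^ (l - 1) else p ^ (l - 1) * (p - 2)) ≤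
      (unitComplements (c : ZMod k)).ncard := by
  induction k using Nat.recOnPosPrimePosCoprime with
  | zero => exact absurd rfl hk
  | one =>
    have : unitComplements (c : ZMod 1) = Set.univ := by
      ext x
      simp [unitComplements, eq_iff_true_of_subsingleton]
    simp [this]
  | prime_pow p l hp hl =>
    rw [Finsupp.prod, Nat.support_factorization, Nat.primeFactors_prime_pow hl.ne' hp,
      Finset.prod_singleton, hp.factorization_pow, Finsupp.single_eq_same]
    split_ifs with h
    · subst h
      exact (ncard_unitComplements_two_pow hl (hc (dvd_pow_self 2 hl.ne'))).ge
    · exact prime_pow_le_ncard_unitComplements hp hl _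
  | coprime a b ha hb hab iha ihb =>
    rw [ncard_unitComplements_mul hab, Nat.factorization_mul_of_coprime hab,
      Finsupp.prod_add_index_of_disjoint hab.disjoint_primeFactors]
    exact Nat.mul_le_mul (iha (by omega) fun h => hc (h.mul_right b))
      (ihb (by omega) fun h => hc (h.mul_left a))

lemma factorization_prod_ite_two {M : Type*} [CommMonoid M] (k : ℕ) (f : ℕ → ℕ → M)
    (hf : f 2 0 = 1) :
    k.factorization.prod f =
      f 2 (k.factorization 2) *
        ∏ p ∈ k.primeFactors.filter (fun p => p ≠ 2), f p (k.factorization p) := by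
  rw [Finset.filter_ne', Finsupp.prod, Nat.support_factorization]
  by_cases h : 2 ∈ k.primeFactors
  · rw [Finset.mul_prod_erase _ (fun p => f p (k.factorization p)) h]
  · rw [Finset.erase_eq_of_notMem h, Finsupp.notMem_support_iff.mp h, hf, one_mul]

lemma card_admFor (n k b1 : ℕ) (hk : k ≠ 0) :
    (admFor n k b1).card = (unitComplements (((n : ℤ) - b1 : ℤ) : ZMod k)).ncard := by
  have : NeZero k := ⟨hk⟩
  rw [← Set.ncard_coe_finset]
  have mem_iff (b : ℕ) (hb : b < k) : b ∈ admFor n k b1 ↔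
      (b : ZMod k) ∈ unitComplements (((n : ℤ) - b1 : ℤ) : ZMod k) := by
    rw [unitComplements, Set.mem_ofPred_eq, ZMod.isUnit_iff_coprime,
      ← Int.cast_natCast (R := ZMod k) b, ← Int.cast_sub, ZMod.coe_int_isUnit_iff_isCoprime,
      isCoprime_comm, Int.isCoprime_iff_gcd_eq_one]
    simp [admFor, redRes, hb]
  have lt_of_mem {b : ℕ} (hb : b ∈ admFor n k b1) : b < k :=
    Finset.mem_range.mp (Finset.mem_filter.mp (Finset.mem_filter.mp hb).1).1
  refine Set.ncard_congr (fun b _ => (b : ZMod k)) ?_ ?_ ?_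
  · intro b hb
    exact (mem_iff b (lt_of_mem hb)).mp hb
  · intro a b ha hb hab
    exact Nat.ModEq.eq_of_lt_of_lt ((ZMod.natCast_eq_natCast_iff a b k).mp hab)
      (lt_of_mem ha) (lt_of_mem hb)
  · intro x hx
    exact ⟨x.val, (mem_iff _ x.val_lt).mpr (by rwa [ZMod.natCast_zmod_val]),
      ZMod.natCast_zmod_val x⟩

theorem stmt5 (n k b1 : ℕ) (hn : Odd n) (hk : 1 ≤ k) (hb1 : b1 ∈ redRes k) :
    2 ^ (k.factorization 2 - 1) *
        ∏ p ∈ k.primeFactors.filter (fun p => p ≠ 2), p ^ (k.factorization p - 1) * (p - 2)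
      ≤ (admFor n k b1).card ∧
    ((2 ^ (k.factorization 2 - 1) *
        ∏ p ∈ k.primeFactors.filter (fun p => p ≠ 2), p ^ (k.factorization p - 1) * (p - 2) : ℕ) : ℝ)
      = (k.totient : ℝ) *
          ∏ p ∈ k.primeFactors.filter (fun p => p ≠ 2), ((p : ℝ) - 2) / ((p : ℝ) - 1) := by
  have hk0 : k ≠ 0 := by omega
  constructor
  · rw [card_admFor n k b1 hk0]
    refine le_trans (le_of_eq ?_) (factorization_prod_le_ncard_unitComplements k _ hk0 ?_)
    · rw [factorization_prod_ite_two _ _ (by simp), if_pos rfl]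
      congr 1
      exact Finset.prod_congr rfl fun p hp => (if_neg (Finset.mem_filter.mp hp).2).symm
    · intro h2
      have hb : Odd b1 :=
        Nat.coprime_two_right.mp ((Finset.mem_filter.mp hb1).2.coprime_dvd_right h2)
      exact ((Int.odd_coe_nat n).mpr hn).sub_odd ((Int.odd_coe_nat b1).mpr hb)
  · rw [Nat.totient_eq_prod_factorization hk0, factorization_prod_ite_two _ _ (by simp),
      Nat.add_one_sub_one, mul_one, Nat.cast_mul, Nat.cast_mul, mul_assoc, Nat.cast_prod,
      Nat.cast_prod, ← Finset.prod_mul_distrib]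
    congr 1
    refine Finset.prod_congr rfl fun p hp => ?_
    have hp2 : 2 ≤ p := (Nat.prime_of_mem_primeFactors (Finset.mem_filter.mp hp).1).two_le
    have hp1 : (p : ℝ) - 1 ≠ 0 := by
      have : (2 : ℝ) ≤ p := by exact_mod_cast hp2
      linarith
    rw [Nat.cast_mul, Nat.cast_mul, Nat.cast_sub hp2, Nat.cast_sub (by omega : 1 ≤ p)]
    push_cast
    field_simp

end
end

section
/- Let α ∈ ℝ and let u, v be integers with v ≥ 1, (u,v) = 1 and |α − u/v| ≤ 1/v². Then for all reals X, Y ≥ 1: ∑_{m ≤ X} min(Y, ‖αm‖^{−1}) ≪ XY/v + (X + v)·log v, with an absolute implied constant (interpreting min(Y, ‖αm‖^{−1}) as Y when ‖αm‖ = 0). -/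
open Finset MeasureTheory

noncomputable section

/-- Multiples `d α` with `0 < d ≤ n / 2` stay at distance at least `1 / (2n)` from the integers
when `α` is within `1 / n²` of a reduced fraction with denominator `n`. -/
lemma inv_two_mul_le_abs_mul_sub_int {α : ℝ} {u : ℤ} {n : ℕ} (hn : 1 ≤ n)
    (hc : Int.gcd u n = 1) (hα : |α - (u : ℝ) / n| ≤ 1 / (n : ℝ) ^ 2)
    {d : ℕ} (hd : 1 ≤ d) (hdn : 2 * d ≤ n) (z : ℤ) :
    1 / (2 * (n : ℝ)) ≤ |α * d - z| := by
  have hn0 : (0 : ℝ) < n := by exact_mod_cast hn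
  have hne : u * d - z * n ≠ 0 := by
    intro h
    have h1 : (n : ℤ) ∣ u * d := ⟨z, by linarith⟩
    have h2 : (n : ℤ) ∣ d := Int.dvd_of_dvd_mul_right_of_gcd_one h1 (by rwa [Int.gcd_comm])
    have h3 := Nat.le_of_dvd (by omega) (Int.natCast_dvd_natCast.mp h2)
    omega
  have h1 : (1 : ℝ) ≤ |(u : ℝ) * d - z * n| := by exact_mod_cast Int.one_le_abs hne
  have h2 : 1 / (n : ℝ) ≤ |(u : ℝ) / n * d - z| := by
    have : (u : ℝ) / n * d - z = (u * d - z * n) / n := by field_simp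
    rw [this, abs_div, abs_of_pos hn0]
    gcongr
  have h3 : |(α - (u : ℝ) / n) * d| ≤ 1 / (2 * (n : ℝ)) := by
    rw [abs_mul, Nat.abs_cast]
    have hd' : (d : ℝ) ≤ n / 2 := by
      have : (2 : ℝ) * d ≤ n := by exact_mod_cast hdn
      linarith
    calc _ ≤ 1 / (n : ℝ) ^ 2 * (n / 2) := by gcongr
      _ = _ := by field_simp
  have h4 : |(u : ℝ) / n * d - z| ≤ |α * d - z| + |(α - (u : ℝ) / n) * d| := by
    have := abs_sub (α * d - z) ((α - (u : ℝ) / n) * d)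
    rwa [show α * d - z - (α - (u : ℝ) / n) * d = (u : ℝ) / n * d - z by ring] at this
  have h5 : 1 / (n : ℝ) = 1 / (2 * n) + 1 / (2 * n) := by field_simp; norm_num
  linarith

/-- A sum of reciprocals of `1 / (2n)`-separated points of `[0, 1/2]`, with every term
truncated at `Z`. -/
lemma sum_le_of_separated {ι : Type*} (T : Finset ι) (F x : ι → ℝ) {n : ℕ} (hn : 1 ≤ n) {Z : ℝ}
    (hZ : 0 ≤ Z) (hx0 : ∀ i ∈ T, 0 ≤ x i) (hx : ∀ i ∈ T, x i ≤ 1 / 2)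
    (hsep : ∀ i ∈ T, ∀ j ∈ T, i ≠ j → 1 / (2 * (n : ℝ)) ≤ |x i - x j|)
    (hFZ : ∀ i ∈ T, F i ≤ Z) (hFx : ∀ i ∈ T, 0 < x i → F i ≤ (x i)⁻¹) :
    ∑ i ∈ T, F i ≤ Z + 2 * n * (1 + Real.log n) := by
  classical
  have hn0 : (0 : ℝ) < n := by exact_mod_cast hn
  set key : ι → ℕ := fun i => ⌊2 * n * x i⌋₊ with hkey
  set g : ℕ → ℝ := fun k => if k = 0 then Z else 2 * n * (k : ℝ)⁻¹ with hg
  have hg0 : ∀ k, 0 ≤ g k := by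
    intro k
    simp only [hg]
    split_ifs
    · exact hZ
    · positivity
  have hle : ∀ i ∈ T, F i ≤ g (key i) := by
    intro i hi
    by_cases h : key i = 0
    · simpa [hg, h] using hFZ i hi
    · have hk : (0 : ℝ) < key i := by exact_mod_cast Nat.pos_of_ne_zero h
      have hfl : (key i : ℝ) ≤ 2 * n * x i :=
        Nat.floor_le (by have := hx0 i hi; positivity)
      have hxk : (key i : ℝ) / (2 * n) ≤ x i := by
        rw [div_le_iff₀ (by positivity)]
        linarith
      have hpos : 0 < (key i : ℝ) / (2 * n) := by positivity
      simp only [hg, h, if_false]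
      calc F i ≤ (x i)⁻¹ := hFx i hi (hpos.trans_le hxk)
        _ ≤ ((key i : ℝ) / (2 * n))⁻¹ := inv_anti₀ hpos hxk
        _ = _ := by rw [inv_div, div_eq_mul_inv]
  have hinj : Set.InjOn key T := by
    intro i hi j hj hij
    by_contra hne
    have h1 := hsep i hi j hj hne
    have h2 : 2 * n * x i < key i + 1 := Nat.lt_floor_add_one _
    have h3 : 2 * n * x j < key j + 1 := Nat.lt_floor_add_one _
    have h4 : (key i : ℝ) ≤ 2 * n * x i :=
      Nat.floor_le (by have := hx0 i hi; positivity)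
    have h5 : (key j : ℝ) ≤ 2 * n * x j :=
      Nat.floor_le (by have := hx0 j hj; positivity)
    rw [hij] at h2 h4
    have h6 : |2 * n * x i - 2 * n * x j| < 1 := by rw [abs_lt]; constructor <;> linarith
    rw [← mul_sub, abs_mul, abs_of_pos (by positivity)] at h6
    rw [div_le_iff₀ (by positivity)] at h1
    linarith
  have himg : T.image key ⊆ Finset.range (n + 1) := by
    intro k hk
    obtain ⟨i, hi, rfl⟩ := Finset.mem_image.mp hk
    rw [Finset.mem_range, Nat.lt_succ_iff]
    apply Nat.floor_le_of_le
    nlinarith [hx i hi]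
  have hharm : ∑ k ∈ Finset.range n, ((k + 1 : ℕ) : ℝ)⁻¹ ≤ 1 + Real.log n := by
    have := harmonic_le_one_add_log n
    simpa [harmonic] using this
  calc ∑ i ∈ T, F i ≤ ∑ i ∈ T, g (key i) := Finset.sum_le_sum hle
    _ = ∑ k ∈ T.image key, g k := (Finset.sum_image hinj).symm
    _ ≤ ∑ k ∈ Finset.range (n + 1), g k :=
        Finset.sum_le_sum_of_subset_of_nonneg himg fun k _ _ => hg0 k
    _ = Z + 2 * n * ∑ k ∈ Finset.range n, ((k + 1 : ℕ) : ℝ)⁻¹ := by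
        rw [Finset.sum_range_succ', Finset.mul_sum]
        simp [hg, add_comm]
    _ ≤ _ := by gcongr

/-- The sum of truncated reciprocals of `‖α m‖` over a set of diameter at most `n / 2`. -/
lemma sum_le_of_short {α : ℝ} {u : ℤ} {n : ℕ} (hn : 1 ≤ n)
    (hc : Int.gcd u n = 1) (hα : |α - (u : ℝ) / n| ≤ 1 / (n : ℝ) ^ 2) (T : Finset ℕ)
    (hT : ∀ i ∈ T, ∀ j ∈ T, i < j → 2 * (j - i) ≤ n) (F : ℕ → ℝ) {Z : ℝ} (hZ : 0 ≤ Z)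
    (hFZ : ∀ i ∈ T, F i ≤ Z)
    (hFx : ∀ i ∈ T, 0 < distNearestInt (α * i) → F i ≤ (distNearestInt (α * i))⁻¹) :
    ∑ i ∈ T, F i ≤ 2 * Z + 4 * n * (1 + Real.log n) := by
  set t : ℕ → ℝ := fun i => α * i - round (α * i) with ht
  have hsep' : ∀ i ∈ T, ∀ j ∈ T, i < j → 1 / (2 * (n : ℝ)) ≤ |t i - t j| := by
    intro i hi j hj hij
    have := inv_two_mul_le_abs_mul_sub_int hn hc hα (d := j - i) (by omega) (hT i hi j hj hij)
      (round (α * j) - round (α * i))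
    rw [abs_sub_comm]
    convert this using 2
    simp only [ht]
    push_cast [Nat.cast_sub hij.le]
    ring
  have hsep : ∀ i ∈ T, ∀ j ∈ T, i ≠ j → 1 / (2 * (n : ℝ)) ≤ |t i - t j| := by
    intro i hi j hj hij
    rcases lt_or_gt_of_ne hij with h | h
    · exact hsep' i hi j hj h
    · rw [abs_sub_comm]
      exact hsep' j hj i hi h
  have habs : ∀ i : ℕ, distNearestInt (α * i) = |t i| := fun i => rfl
  have hhalf : ∀ i, |t i| ≤ 1 / 2 := fun i => abs_sub_round _
  rw [← Finset.sum_filter_add_sum_filter_not T (fun i => 0 ≤ t i)]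
  have hpos : ∑ i ∈ T.filter (fun i => 0 ≤ t i), F i ≤ Z + 2 * n * (1 + Real.log n) := by
    refine sum_le_of_separated _ F t hn hZ ?_ ?_ ?_ ?_ ?_
    · exact fun i hi => (Finset.mem_filter.mp hi).2
    · exact fun i _ => (le_abs_self _).trans (hhalf i)
    · exact fun i hi j hj => hsep i (Finset.mem_filter.mp hi).1 j (Finset.mem_filter.mp hj).1
    · exact fun i hi => hFZ i (Finset.mem_filter.mp hi).1
    · intro i hi h
      have := hFx i (Finset.mem_filter.mp hi).1
      rw [habs, abs_of_pos h] at this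
      exact this h
  have hneg : ∑ i ∈ T.filter (fun i => ¬ 0 ≤ t i), F i ≤ Z + 2 * n * (1 + Real.log n) := by
    refine sum_le_of_separated _ F (fun i => -t i) hn hZ ?_ ?_ ?_ ?_ ?_
    · intro i hi
      have := (Finset.mem_filter.mp hi).2
      linarith
    · exact fun i _ => (neg_le_abs _).trans (hhalf i)
    · intro i hi j hj hij
      have := hsep i (Finset.mem_filter.mp hi).1 j (Finset.mem_filter.mp hj).1 hij
      rwa [← abs_neg, show -(t i - t j) = -t i - -t j by ring] at this
    · exact fun i hi => hFZ i (Finset.mem_filter.mp hi).1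
    · intro i hi h
      have := hFx i (Finset.mem_filter.mp hi).1
      rw [habs, abs_of_neg (by linarith)] at this
      exact this h
  linarith

theorem stmt8 :
    ∃ C > (0:ℝ), ∀ α : ℝ, ∀ u v : ℤ, 1 ≤ v → Int.gcd u v = 1 →
      |α - (u : ℝ) / v| ≤ 1 / (v : ℝ) ^ 2 → ∀ X Y : ℝ, 1 ≤ X → 1 ≤ Y →
      ∑ m ∈ Finset.Icc 1 ⌊X⌋₊,
          (if distNearestInt (α * m) = 0 then Y else min Y (distNearestInt (α * m))⁻¹)
        ≤ C * (X * Y / (v : ℝ) + (X + (v : ℝ)) * Real.log v) := by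
  refine ⟨30, by norm_num, ?_⟩
  intro α u v hv hc hα X Y hX hY
  obtain ⟨n, rfl⟩ := Int.eq_ofNat_of_zero_le (by omega : 0 ≤ v)
  have hn : 1 ≤ n := by exact_mod_cast hv
  rw [Int.cast_natCast] at hα ⊢
  have hn0 : (0 : ℝ) < n := by exact_mod_cast hn
  set F : ℕ → ℝ := fun m =>
    if distNearestInt (α * m) = 0 then Y else min Y (distNearestInt (α * m))⁻¹ with hF
  have hFY : ∀ m, F m ≤ Y := by
    intro m
    simp only [hF]
    split_ifs
    · exact le_rfl
    · exact min_le_left _ _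
  have hFx : ∀ m : ℕ, 0 < distNearestInt (α * m) → F m ≤ (distNearestInt (α * m))⁻¹ := by
    intro m hm
    simp only [hF, hm.ne']
    exact min_le_right _ _
  have hfloor : (⌊X⌋₊ : ℝ) ≤ X := Nat.floor_le (by linarith)
  have hXY : 0 < X * Y := by positivity
  rcases hn.eq_or_lt with rfl | hn2
  · have : ∑ m ∈ Finset.Icc 1 ⌊X⌋₊, F m ≤ X * Y := by
      calc _ ≤ (Finset.Icc 1 ⌊X⌋₊).card • Y := Finset.sum_le_card_nsmul _ _ _ fun m _ => hFY m
        _ = ⌊X⌋₊ * Y := by simp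
        _ ≤ X * Y := by gcongr
    simp only [Nat.cast_one, div_one, Real.log_one, mul_zero, add_zero]
    linarith
  have hlog : 1 ≤ 3 / 2 * Real.log n := by
    have h1 : Real.log 2 ≤ Real.log n := Real.log_le_log (by norm_num) (by exact_mod_cast hn2)
    linarith [Real.log_two_gt_d9]
  set L := n / 2 with hL
  have hL0 : 0 < L := by omega
  have hLn : (n : ℝ) ≤ 3 * L := by
    have : n ≤ 3 * L := by omega
    exact_mod_cast this
  set K := ⌊X⌋₊ / L with hK
  have hKX : (K : ℝ) ≤ 3 * X / n := by
    have h1 : ((K * L : ℕ) : ℝ) ≤ ⌊X⌋₊ := by exact_mod_cast Nat.div_mul_le_self _ _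
    push_cast at h1
    rw [le_div_iff₀ hn0]
    nlinarith [(Nat.cast_nonneg K : (0 : ℝ) ≤ K)]
  have hshort : ∀ k, ∀ i ∈ (Finset.Icc 1 ⌊X⌋₊).filter (fun m => m / L = k),
      ∀ j ∈ (Finset.Icc 1 ⌊X⌋₊).filter (fun m => m / L = k), i < j → 2 * (j - i) ≤ n := by
    intro k i hi j hj _
    have h1 := Nat.div_add_mod i L
    have h2 := Nat.div_add_mod j L
    rw [(Finset.mem_filter.mp hi).2] at h1
    rw [(Finset.mem_filter.mp hj).2] at h2
    have h3 := Nat.mod_lt j hL0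
    omega
  have hblock : ∀ k, ∑ m ∈ (Finset.Icc 1 ⌊X⌋₊).filter (fun m => m / L = k), F m
      ≤ 2 * Y + 10 * (n * Real.log n) := by
    intro k
    have := sum_le_of_short hn hc hα _ (hshort k) F (by linarith : 0 ≤ Y) (fun i _ => hFY i)
      (fun i _ => hFx i)
    nlinarith
  have hzero : ∑ m ∈ (Finset.Icc 1 ⌊X⌋₊).filter (fun m => m / L = 0), F m
      ≤ 30 * (n * Real.log n) := by
    have := sum_le_of_short hn hc hα _ (hshort 0) F (by positivity : (0 : ℝ) ≤ 2 * n) ?_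
      (fun i _ => hFx i)
    · nlinarith
    intro i hi
    obtain ⟨hi1, hi2⟩ := Finset.mem_filter.mp hi
    have hi3 := (Finset.mem_Icc.mp hi1).1
    have hi4 : i < L := by
      rcases Nat.div_eq_zero_iff.mp hi2 with h | h <;> omega
    have hd : 1 / (2 * (n : ℝ)) ≤ distNearestInt (α * i) :=
      inv_two_mul_le_abs_mul_sub_int hn hc hα hi3 (by omega) _
    have hp : 0 < 1 / (2 * (n : ℝ)) := by positivity
    calc F i ≤ (distNearestInt (α * i))⁻¹ := hFx i (hp.trans_le hd)
      _ ≤ (1 / (2 * (n : ℝ)))⁻¹ := inv_anti₀ hp hd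
      _ = 2 * n := by simp
  have hsplit : ∑ m ∈ Finset.Icc 1 ⌊X⌋₊, F m
      = ∑ k ∈ Finset.range (K + 1),
        ∑ m ∈ (Finset.Icc 1 ⌊X⌋₊).filter (fun m => m / L = k), F m := by
    refine (Finset.sum_fiberwise_of_maps_to ?_ F).symm
    intro m hm
    rw [Finset.mem_range, Nat.lt_succ_iff]
    exact Nat.div_le_div_right (Finset.mem_Icc.mp hm).2
  have hrest : ∑ k ∈ Finset.range K,
      ∑ m ∈ (Finset.Icc 1 ⌊X⌋₊).filter (fun m => m / L = k + 1), F m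
      ≤ 3 * X / n * (2 * Y + 10 * (n * Real.log n)) := by
    have hlog0 : 0 ≤ Real.log n := by linarith
    calc _ ≤ (Finset.range K).card • (2 * Y + 10 * (n * Real.log n)) :=
          Finset.sum_le_card_nsmul _ _ _ fun k _ => hblock (k + 1)
      _ = K * (2 * Y + 10 * (n * Real.log n)) := by rw [Finset.card_range, nsmul_eq_mul]
      _ ≤ _ := by gcongr
  have hexp : 3 * X / n * (2 * Y + 10 * (n * Real.log n))
      = 6 * (X * Y / n) + 30 * (X * Real.log n) := by
    field_simp
    ring
  have hpos : 0 < X * Y / n := by positivity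
  rw [hsplit, Finset.sum_range_succ']
  linarith
end
end

section
/- For every A > 0 and ε > 0 there is a constant C such that for all sufficiently large n and all D ≤ n^{1/5−ε}: ∑_{D < k ≤ 2D} k · max_{b₁,b₂,b₃ admissible mod k} W₃(k; b₁,b₂,b₃) ≤ C · n²/(log n)^{A+3}, where W₃(k; b₁,b₂,b₃) is the number of solutions of p^l + q^j + r^m = n in primes p, q, r and positive integer exponents l, j, m with max(l, j, m) ≥ 2, p^l ≡ b₁ (mod k), q^j ≡ b₂ (mod k), r^m ≡ b₃ (mod k). -/
open Finset MeasureTheory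

noncomputable section

/-- Solutions of `p^l + q^j + r^m = n` with `l ≥ 2` and `q^j` in a fixed residue class mod `k`,
seen through coordinate functions `f, g, h` on an arbitrary index type. -/
theorem ncard_primePow_solutions_le {X : Type*} (s : Set X) (f g h : X → ℕ × ℕ)
    (hinj : ∀ x y, f x = f y → g x = g y → h x = h y → x = y) (n k b : ℕ)
    (hs : ∀ x ∈ s, (f x).1.Prime ∧ (g x).1.Prime ∧ (h x).1.Prime ∧
      2 ≤ (f x).2 ∧ 1 ≤ (g x).2 ∧ 1 ≤ (h x).2 ∧
      (f x).1 ^ (f x).2 + (g x).1 ^ (g x).2 + (h x).1 ^ (h x).2 = n ∧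
      (g x).1 ^ (g x).2 % k = b % k) :
    s.ncard ≤ (Nat.sqrt n + 1) * (Nat.log 2 n + 1) * (n / k + 1) := by
  have key : s.ncard ≤ ((((Finset.range (Nat.sqrt n + 1) ×ˢ Finset.range (Nat.log 2 n + 1)) ×ˢ
      Finset.range (n / k + 1) : Finset ((ℕ × ℕ) × ℕ))) : Set ((ℕ × ℕ) × ℕ)).ncard := by
    refine Set.ncard_le_ncard_of_injOn (fun x => (f x, (g x).1 ^ (g x).2 / k)) ?_ ?_
      (Finset.finite_toSet _)
    · intro x hx
      obtain ⟨hp, hq, hr, hl, hj, hm, hsum, hmod⟩ := hs x hx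
      have hle : (f x).1 ^ (f x).2 ≤ n := by omega
      simp only [Finset.coe_product, Set.mem_prod, Finset.mem_coe, Finset.mem_range,
        Nat.lt_succ_iff]
      refine ⟨⟨?_, ?_⟩, Nat.div_le_div_right (by omega)⟩
      · rw [Nat.le_sqrt']
        exact (Nat.pow_le_pow_right hp.pos hl).trans hle
      · exact Nat.le_log_of_pow_le (by norm_num) ((Nat.pow_le_pow_left hp.two_le _).trans hle)
    · intro x hx y hy hxy
      obtain ⟨hp, hq, hr, hl, hj, hm, hsum, hmod⟩ := hs x hx
      obtain ⟨hp', hq', hr', hl', hj', hm', hsum', hmod'⟩ := hs y hy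
      obtain ⟨hf, hdiv⟩ := Prod.mk.inj hxy
      have hg : (g x).1 ^ (g x).2 = (g y).1 ^ (g y).2 := by
        rw [← Nat.div_add_mod ((g x).1 ^ (g x).2) k, ← Nat.div_add_mod ((g y).1 ^ (g y).2) k,
          hdiv, hmod, hmod']
      have hh : (h x).1 ^ (h x).2 = (h y).1 ^ (h y).2 := by
        rw [hf] at hsum
        omega
      have inj : ∀ u v : ℕ × ℕ, u.1.Prime → v.1.Prime → 1 ≤ u.2 → 1 ≤ v.2 →
          u.1 ^ u.2 = v.1 ^ v.2 → u = v := by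
        rintro ⟨p, i⟩ ⟨q, j⟩ hp hq hi hj huv
        simp only at hp hq hi hj huv
        have hpq : p = q := (Nat.prime_dvd_prime_iff_eq hp hq).1
          (hp.dvd_of_dvd_pow (huv ▸ dvd_pow_self p (by omega)))
        subst hpq
        exact Prod.ext rfl (Nat.pow_right_injective hp.two_le huv)
      exact hinj x y hf (inj _ _ hq hq' hj hj' hg) (inj _ _ hr hr' hm hm' hh)
  refine key.trans (le_of_eq ?_)
  rw [Set.ncard_coe_finset]
  simp

theorem W3_le (n k b1 b2 b3 : ℕ) :
    W3 n k b1 b2 b3 ≤ 3 * ((Nat.sqrt n + 1) * (Nat.log 2 n + 1) * (n / k + 1)) := by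
  unfold W3
  set s := {x : (ℕ × ℕ) × (ℕ × ℕ) × (ℕ × ℕ) |
    x.1.1.Prime ∧ x.2.1.1.Prime ∧ x.2.2.1.Prime ∧
    1 ≤ x.1.2 ∧ 1 ≤ x.2.1.2 ∧ 1 ≤ x.2.2.2 ∧
    (2 ≤ x.1.2 ∨ 2 ≤ x.2.1.2 ∨ 2 ≤ x.2.2.2) ∧
    x.1.1 ^ x.1.2 + x.2.1.1 ^ x.2.1.2 + x.2.2.1 ^ x.2.2.2 = n ∧
    x.1.1 ^ x.1.2 % k = b1 % k ∧ x.2.1.1 ^ x.2.1.2 % k = b2 % k ∧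
    x.2.2.1 ^ x.2.2.2 % k = b3 % k} with hs
  have hunion : s = (s ∩ {x | 2 ≤ x.1.2}) ∪ (s ∩ {x | 2 ≤ x.2.1.2}) ∪
      (s ∩ {x | 2 ≤ x.2.2.2}) := by
    ext x
    simp only [hs, Set.mem_union, Set.mem_inter_iff, Set.mem_ofPred_eq]
    tauto
  have h₁ := ncard_primePow_solutions_le (s ∩ {x | 2 ≤ x.1.2}) (fun x => x.1) (fun x => x.2.1)
    (fun x => x.2.2) (fun x y ha hb hc => Prod.ext ha (Prod.ext hb hc)) n k b2 (by
      rintro x ⟨⟨hp, hq, hr, hl, hj, hm, -, hsum, h1, h2, h3⟩, hx⟩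
      exact ⟨hp, hq, hr, hx, hj, hm, hsum, h2⟩)
  have h₂ := ncard_primePow_solutions_le (s ∩ {x | 2 ≤ x.2.1.2}) (fun x => x.2.1) (fun x => x.1)
    (fun x => x.2.2) (fun x y ha hb hc => Prod.ext hb (Prod.ext ha hc)) n k b1 (by
      rintro x ⟨⟨hp, hq, hr, hl, hj, hm, -, hsum, h1, h2, h3⟩, hx⟩
      exact ⟨hq, hp, hr, hx, hl, hm, by omega, h1⟩)
  have h₃ := ncard_primePow_solutions_le (s ∩ {x | 2 ≤ x.2.2.2}) (fun x => x.2.2) (fun x => x.1)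
    (fun x => x.2.1) (fun x y ha hb hc => Prod.ext hb (Prod.ext hc ha)) n k b1 (by
      rintro x ⟨⟨hp, hq, hr, hl, hj, hm, -, hsum, h1, h2, h3⟩, hx⟩
      exact ⟨hr, hp, hq, hx, hl, hj, by omega, h1⟩)
  have h₄ := Set.ncard_union_le (s ∩ {x | 2 ≤ x.1.2} ∪ s ∩ {x | 2 ≤ x.2.1.2})
    (s ∩ {x | 2 ≤ x.2.2.2})
  have h₅ := Set.ncard_union_le (s ∩ {x | 2 ≤ x.1.2}) (s ∩ {x | 2 ≤ x.2.1.2})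
  rw [← hunion] at h₄
  omega

theorem mul_sup_W3_le (n k : ℕ) :
    k * ((admTriplets n k).sup fun b => W3 n k b.1 b.2.1 b.2.2) ≤
      3 * ((Nat.sqrt n + 1) * (Nat.log 2 n + 1) * (n + k)) := by
  have hsup : ((admTriplets n k).sup fun b => W3 n k b.1 b.2.1 b.2.2) ≤
      3 * ((Nat.sqrt n + 1) * (Nat.log 2 n + 1) * (n / k + 1)) :=
    Finset.sup_le fun b _ => W3_le n k _ _ _
  have hk : k * (n / k + 1) ≤ n + k := by
    have := Nat.mul_div_le n k
    linarith
  calc _ ≤ k * (3 * ((Nat.sqrt n + 1) * (Nat.log 2 n + 1) * (n / k + 1))) :=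
        Nat.mul_le_mul_left _ hsup
    _ = 3 * ((Nat.sqrt n + 1) * (Nat.log 2 n + 1) * (k * (n / k + 1))) := by ring
    _ ≤ _ := by gcongr

theorem card_kRange_le {D : ℝ} (hD : 0 ≤ D) : ((kRange D).card : ℝ) ≤ 2 * D := by
  have hsub : kRange D ⊆ Finset.Icc 1 ⌊2 * D⌋₊ := by
    intro k hk
    simp only [kRange, Finset.mem_filter, Finset.mem_range] at hk
    have : (0 : ℝ) < k := hD.trans_lt hk.2.1
    rw [Finset.mem_Icc]
    exact ⟨by exact_mod_cast this, by omega⟩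
  calc ((kRange D).card : ℝ) ≤ (⌊2 * D⌋₊ : ℝ) := by
        exact_mod_cast (Finset.card_le_card hsub).trans (by simp)
    _ ≤ 2 * D := Nat.floor_le (by linarith)

theorem kRange_eq_empty {D : ℝ} (hD : D < 0) : kRange D = ∅ := by
  refine Finset.filter_eq_empty_iff.2 fun k _ hk => ?_
  linarith [hk.1, hk.2]

theorem sum_mul_sup_W3_le {n : ℕ} (hn : 3 ≤ n) {D : ℝ} (hD : D ≤ (n : ℝ) ^ ((1 : ℝ) / 5)) :
    ∑ k ∈ kRange D, (k : ℝ) * (((admTriplets n k).sup fun b => W3 n k b.1 b.2.1 b.2.2 : ℕ) : ℝ)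
      ≤ 108 * ((n : ℝ) ^ ((17 : ℝ) / 10) * Real.log n) := by
  have hn3 : (3 : ℝ) ≤ n := by exact_mod_cast hn
  have hn1 : (1 : ℝ) ≤ n := by linarith
  have hn0 : (0 : ℝ) < n := by linarith
  have hlog : 1 ≤ Real.log n := by
    rw [Real.le_log_iff_exp_le hn0]
    linarith [Real.exp_one_lt_d9]
  rcases lt_or_ge D 0 with hneg | hD0
  · rw [kRange_eq_empty hneg, Finset.sum_empty]
    positivity
  have hsqrt : ((Nat.sqrt n : ℕ) : ℝ) + 1 ≤ 2 * (n : ℝ) ^ ((1 : ℝ) / 2) := by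
    have h₁ := Real.nat_sqrt_le_real_sqrt (a := n)
    rw [Real.sqrt_eq_rpow] at h₁
    have h₂ : (1 : ℝ) ≤ (n : ℝ) ^ ((1 : ℝ) / 2) := Real.one_le_rpow hn1 (by norm_num)
    linarith
  have hlogb : ((Nat.log 2 n : ℕ) : ℝ) + 1 ≤ 3 * Real.log n := by
    have h₁ : ((2 : ℝ)) ^ (Nat.log 2 n) ≤ n := by
      exact_mod_cast Nat.pow_log_le_self 2 (by omega : n ≠ 0)
    have h₂ := Real.log_le_log (by positivity) h₁
    rw [Real.log_pow] at h₂
    nlinarith [Real.log_two_gt_d9, Nat.cast_nonneg (α := ℝ) (Nat.log 2 n)]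
  have hDn : D ≤ n := hD.trans <| by
    simpa using Real.rpow_le_rpow_of_exponent_le hn1 (by norm_num : (1 : ℝ) / 5 ≤ 1)
  have hterm : ∀ k ∈ kRange D,
      (k : ℝ) * (((admTriplets n k).sup fun b => W3 n k b.1 b.2.1 b.2.2 : ℕ) : ℝ) ≤
        3 * ((2 * (n : ℝ) ^ ((1 : ℝ) / 2)) * (3 * Real.log n) * (3 * n)) := by
    intro k hk
    simp only [kRange, Finset.mem_filter, Finset.mem_range] at hk
    have h₁ : (k : ℝ) * (((admTriplets n k).sup fun b => W3 n k b.1 b.2.1 b.2.2 : ℕ) : ℝ) ≤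
        3 * ((((Nat.sqrt n : ℕ) : ℝ) + 1) * (((Nat.log 2 n : ℕ) : ℝ) + 1) * (n + k)) := by
      exact_mod_cast mul_sup_W3_le n k
    have h₂ : (n : ℝ) + k ≤ 3 * n := by linarith [hk.2.2]
    exact h₁.trans (by gcongr)
  calc _ ≤ ((kRange D).card : ℝ) *
        (3 * ((2 * (n : ℝ) ^ ((1 : ℝ) / 2)) * (3 * Real.log n) * (3 * n))) := by
        simpa using Finset.sum_le_card_nsmul _ _ _ hterm
    _ ≤ (2 * (n : ℝ) ^ ((1 : ℝ) / 5)) *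
        (3 * ((2 * (n : ℝ) ^ ((1 : ℝ) / 2)) * (3 * Real.log n) * (3 * n))) := by
        gcongr
        linarith [card_kRange_le hD0]
    _ = 108 * (((n : ℝ) ^ ((1 : ℝ) / 5) * (n : ℝ) ^ ((1 : ℝ) / 2) * (n : ℝ) ^ (1 : ℝ)) *
        Real.log n) := by rw [Real.rpow_one]; ring
    _ = _ := by
        rw [← Real.rpow_add hn0, ← Real.rpow_add hn0]
        norm_num

theorem stmt14 (A ε : ℝ) (hA : 0 < A) (hε : 0 < ε) :
    ∃ C > (0:ℝ), ∃ N : ℕ, ∀ n : ℕ, N ≤ n → ∀ D : ℝ, D ≤ (n : ℝ) ^ ((1:ℝ)/5 - ε) →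
      ∑ k ∈ kRange D, (k : ℝ) * (((admTriplets n k).sup fun b => W3 n k b.1 b.2.1 b.2.2 : ℕ) : ℝ)
        ≤ C * (n : ℝ) ^ 2 / Real.log n ^ (A + 3) := by
  have hlogpow := ((isLittleO_log_rpow_rpow_atTop (A + 4)
    (by norm_num : (0 : ℝ) < 3 / 10)).bound one_pos).natCast_atTop
  obtain ⟨N, hN⟩ := Filter.eventually_atTop.1 hlogpow
  refine ⟨108, by norm_num, max N 3, fun n hn D hD => ?_⟩
  have hn3 : 3 ≤ n := (le_max_right _ _).trans hn
  have hn1 : (1 : ℝ) < n := by exact_mod_cast (by omega : 1 < n)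
  have hn0 : (0 : ℝ) < n := by linarith
  have hlog : 0 < Real.log n := Real.log_pos hn1
  have hD' : D ≤ (n : ℝ) ^ ((1 : ℝ) / 5) :=
    hD.trans (Real.rpow_le_rpow_of_exponent_le hn1.le (by linarith))
  have hsmall := hN n ((le_max_left _ _).trans hn)
  rw [one_mul, Real.norm_of_nonneg (by positivity), Real.norm_of_nonneg (by positivity)] at hsmall
  refine (sum_mul_sup_W3_le hn3 hD').trans ?_
  rw [le_div_iff₀ (by positivity)]
  calc 108 * ((n : ℝ) ^ ((17 : ℝ) / 10) * Real.log n) * Real.log n ^ (A + 3)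
      = 108 * ((n : ℝ) ^ ((17 : ℝ) / 10) * (Real.log n ^ (1 : ℝ) * Real.log n ^ (A + 3))) := by
        rw [Real.rpow_one]; ring
    _ = 108 * ((n : ℝ) ^ ((17 : ℝ) / 10) * Real.log n ^ (A + 4)) := by
        rw [← Real.rpow_add hlog]
        ring_nf
    _ ≤ 108 * ((n : ℝ) ^ ((17 : ℝ) / 10) * (n : ℝ) ^ ((3 : ℝ) / 10)) := by gcongr
    _ = 108 * (n : ℝ) ^ 2 := by
        rw [← Real.rpow_add hn0, ← Real.rpow_natCast]
        norm_num

end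
end
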